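/- Let n ≥ 1 be an integer, Δ > 0, T = nΔ, h > 0 and x* ∈ ℝ. On a probability space let X_0, …, X_{n−1} be real random variables, each having density π with respect to Lebesgue measure with ‖π‖_∞ < ∞. Assume that for each j ∈ {1, …, n−1} there is a measurable function g_j : ℝ² → ℝ such that for every i with i + j ≤ n−1 the pair (X_i, X_{i+j}) has joint density (y, z) ↦ π(y)π(z) + g_j(y, z), and that there is a constant M₁ < ∞ with Δ · Σ_{j=1}^{n−1} |g_j(y, z)| ≤ M₁ for all (y, z) ∈ ℝ². Let K ∈ L¹(ℝ) ∩ L²(ℝ) and set π̂ = (1/n) Σ_{i=0}^{n−1} (1/h) K((x* − X_i)/h). Then Var(π̂) ≤ ‖π‖_∞ ‖K‖_{L²}² Δ/(T h) + 2 ‖K‖_{L¹}² M₁ / T. -/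

import Mathlib

open MeasureTheory ProbabilityTheory

lemma integrable_comp_sub_left_div {f : ℝ → ℝ} (hf : Integrable f) {h : ℝ} (hh : 0 < h) (x : ℝ) :
    Integrable (fun y => f ((x - y) / h)) :=
  (hf.comp_div hh.ne').comp_sub_left x

lemma integral_comp_sub_left_div (f : ℝ → ℝ) {h : ℝ} (hh : 0 < h) (x : ℝ) :
    ∫ y, f ((x - y) / h) = h * ∫ y, f y := by
  rw [integral_sub_left_eq_self (fun y => f (y / h)) volume x, Measure.integral_comp_div,
    abs_of_pos hh, smul_eq_mul]

lemma toReal_eLpNorm_two_sq {α : Type*} [MeasurableSpace α] {μ : Measure α} {f : α → ℝ}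
    (hf : MemLp f 2 μ) : (eLpNorm f 2 μ).toReal ^ 2 = ∫ x, f x ^ 2 ∂μ := by
  have h0 : 0 ≤ ∫ x, f x ^ 2 ∂μ := integral_nonneg fun x => sq_nonneg _
  rw [hf.eLpNorm_eq_integral_rpow_norm (by simp) (by simp), ENNReal.toReal_ofReal (by positivity)]
  simp only [ENNReal.toReal_ofNat, Real.rpow_ofNat, Real.norm_eq_abs, sq_abs]
  rw [← Real.rpow_natCast, ← Real.rpow_mul h0]
  simp

lemma toReal_eLpNorm_one {α : Type*} [MeasurableSpace α] {μ : Measure α} {f : α → ℝ}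
    (hf : MemLp f 1 μ) : (eLpNorm f 1 μ).toReal = ∫ x, |f x| ∂μ := by
  rw [toReal_eLpNorm hf.1, lpNorm_one_eq_integral_norm hf.1]
  rfl

lemma withDensity_le_eLpNorm_top_smul {α : Type*} [MeasurableSpace α] (μ : Measure α)
    (f : α → ℝ) :
    μ.withDensity (fun y => ENNReal.ofReal (f y)) ≤ eLpNorm f ⊤ μ • μ := by
  rw [← withDensity_const]
  refine withDensity_mono ?_
  filter_upwards [ae_le_eLpNormEssSup (f := f) (μ := μ)] with y hy
  rw [eLpNorm_exponent_top]
  exact (Real.ofReal_le_enorm _).trans hy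

/-- A Toeplitz-type row bound: off-diagonal entries controlled by the distance to the diagonal. -/
lemma sum_range_le_of_dist_bound {n i : ℕ} (hi : i < n) (c d : ℕ → ℝ) (V D : ℝ)
    (hd : ∀ j, 0 ≤ d j) (hD : ∑ j ∈ Finset.Icc 1 (n - 1), d j ≤ D) (hV : c i ≤ V)
    (hlt : ∀ j < i, c j ≤ d (i - j)) (hgt : ∀ j, i < j → j < n → c j ≤ d (j - i)) :
    ∑ j ∈ Finset.range n, c j ≤ V + 2 * D := by
  have hsum : ∀ m ≤ n - 1, ∑ j ∈ Finset.range m, d (j + 1) ≤ D := by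
    intro m hm
    refine le_trans ?_ hD
    have h1 : ∑ j ∈ Finset.Icc 1 (n - 1), d j = ∑ j ∈ Finset.range (n - 1), d (j + 1) := by
      rw [Finset.range_eq_Ico, Finset.sum_Ico_add' d 0 (n - 1) 1]
      rfl
    rw [h1]
    exact Finset.sum_le_sum_of_subset_of_nonneg (Finset.range_mono hm) fun _ _ _ => hd _
  obtain ⟨m, rfl⟩ : ∃ m, n = i + 1 + m := ⟨n - (i + 1), by omega⟩
  rw [Finset.sum_range_add, Finset.sum_range_succ]
  have hleft : ∑ j ∈ Finset.range i, c j ≤ D := by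
    refine le_trans ?_ (hsum i (by omega))
    rw [← Finset.sum_range_reflect (fun j => d (j + 1))]
    refine Finset.sum_le_sum fun j hj => ?_
    have hj' := Finset.mem_range.1 hj
    have := hlt j hj'
    rwa [show i - j = i - 1 - j + 1 by omega] at this
  have hright : ∑ j ∈ Finset.range m, c (i + 1 + j) ≤ D := by
    refine le_trans ?_ (hsum m (by omega))
    refine Finset.sum_le_sum fun j hj => ?_
    have hj' := Finset.mem_range.1 hj
    have := hgt (i + 1 + j) (by omega) (by omega)
    rwa [show i + 1 + j - i = j + 1 by omega] at this
  linarith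

/-- A covariance bound when the joint density differs from the product of the marginal densities
by a function integrable against the kernel. -/
lemma covariance_comp_le_of_joint_density {Ω : Type*} [MeasurableSpace Ω] {μ : Measure Ω}
    [IsProbabilityMeasure μ] {U V : Ω → ℝ} (hU : Measurable U) (hV : Measurable V)
    {p k : ℝ → ℝ} (hp : Measurable p) (hp0 : ∀ y, 0 ≤ p y)
    (hUp : μ.map U = volume.withDensity fun y => ENNReal.ofReal (p y))
    (hVp : μ.map V = volume.withDensity fun y => ENNReal.ofReal (p y))
    {g : ℝ → ℝ → ℝ} (hg : Measurable (Function.uncurry g))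
    (hUV : μ.map (fun ω => (U ω, V ω)) = (volume : Measure (ℝ × ℝ)).withDensity
      fun yz => ENNReal.ofReal (p yz.1 * p yz.2 + g yz.1 yz.2))
    (hk : AEStronglyMeasurable k)
    (hk2 : MemLp k 2 (volume.withDensity fun y => ENNReal.ofReal (p y)))
    (hkg : Integrable fun yz : ℝ × ℝ => g yz.1 yz.2 * (|k yz.1| * |k yz.2|)) :
    cov[fun ω => k (U ω), fun ω => k (V ω); μ]
      ≤ ∫ yz : ℝ × ℝ, |g yz.1 yz.2| * (|k yz.1| * |k yz.2|) := by
  have hkU : MemLp (fun ω => k (U ω)) 2 μ := (hUp ▸ hk2).comp_of_map hU.aemeasurable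
  have hkV : MemLp (fun ω => k (V ω)) 2 μ := (hVp ▸ hk2).comp_of_map hV.aemeasurable
  have hpk : Integrable (fun y => p y * k y) := by
    have h1 : Integrable k (volume.withDensity fun y => ENNReal.ofReal (p y)) := by
      rw [← hUp] at hk2 ⊢
      have := Measure.isProbabilityMeasure_map (μ := μ) hU.aemeasurable
      exact hk2.integrable (by norm_num)
    rw [integrable_withDensity_iff_integrable_smul' hp.ennreal_ofReal (by simp)] at h1
    simpa only [ENNReal.toReal_ofReal (hp0 _), smul_eq_mul] using h1
  have hmean : ∀ W : Ω → ℝ, Measurable W →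
      μ.map W = volume.withDensity (fun y => ENNReal.ofReal (p y)) →
      ∫ ω, k (W ω) ∂μ = ∫ y, p y * k y := by
    intro W hW hWp
    rw [← integral_map (f := k) hW.aemeasurable
      (by rw [hWp]; exact hk2.1), hWp,
      integral_withDensity_eq_integral_toReal_smul hp.ennreal_ofReal (by simp)]
    simp only [ENNReal.toReal_ofReal (hp0 _), smul_eq_mul]
  have hkk : AEStronglyMeasurable (fun yz : ℝ × ℝ => k yz.1 * k yz.2) :=
    hk.comp_fst.mul hk.comp_snd
  have hw : Measurable fun yz : ℝ × ℝ => p yz.1 * p yz.2 + g yz.1 yz.2 :=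
    ((hp.comp measurable_fst).mul (hp.comp measurable_snd)).add hg
  have hjoint : ∫ ω, k (U ω) * k (V ω) ∂μ
      = ∫ yz : ℝ × ℝ, max (p yz.1 * p yz.2 + g yz.1 yz.2) 0 * (k yz.1 * k yz.2) := by
    rw [← integral_map (f := fun yz : ℝ × ℝ => k yz.1 * k yz.2) (hU.prodMk hV).aemeasurable
      (by rw [hUV]; exact hkk.mono_ac (withDensity_absolutelyContinuous _ _)), hUV,
      integral_withDensity_eq_integral_toReal_smul hw.ennreal_ofReal (by simp)]
    simp only [ENNReal.toReal_ofReal', smul_eq_mul]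
  have hprod : Integrable fun yz : ℝ × ℝ => (p yz.1 * k yz.1) * (p yz.2 * k yz.2) :=
    hpk.mul_prod hpk
  have hbound : ∀ yz : ℝ × ℝ, |max (p yz.1 * p yz.2 + g yz.1 yz.2) 0 * (k yz.1 * k yz.2)
      - (p yz.1 * k yz.1) * (p yz.2 * k yz.2)| ≤ |g yz.1 yz.2| * (|k yz.1| * |k yz.2|) := by
    intro yz
    have ha : 0 ≤ p yz.1 * p yz.2 := mul_nonneg (hp0 _) (hp0 _)
    rw [show max (p yz.1 * p yz.2 + g yz.1 yz.2) 0 * (k yz.1 * k yz.2)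
      - (p yz.1 * k yz.1) * (p yz.2 * k yz.2)
      = (max (p yz.1 * p yz.2 + g yz.1 yz.2) 0 - p yz.1 * p yz.2) * (k yz.1 * k yz.2) by ring,
      abs_mul, abs_mul (k yz.1)]
    refine mul_le_mul_of_nonneg_right ?_ (by positivity)
    simpa [max_eq_left ha] using
      abs_max_sub_max_le_abs (p yz.1 * p yz.2 + g yz.1 yz.2) (p yz.1 * p yz.2) 0
  have hkg' : Integrable fun yz : ℝ × ℝ => |g yz.1 yz.2| * (|k yz.1| * |k yz.2|) := by
    simpa [abs_mul] using hkg.abs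
  have hdiff : Integrable fun yz : ℝ × ℝ =>
      max (p yz.1 * p yz.2 + g yz.1 yz.2) 0 * (k yz.1 * k yz.2)
        - (p yz.1 * k yz.1) * (p yz.2 * k yz.2) :=
    hkg'.mono' (((hw.max measurable_const).aestronglyMeasurable.mul hkk).sub hprod.1)
      (Filter.Eventually.of_forall hbound)
  have hmain : Integrable fun yz : ℝ × ℝ =>
      max (p yz.1 * p yz.2 + g yz.1 yz.2) 0 * (k yz.1 * k yz.2) := by
    exact (hdiff.add hprod).congr (Filter.Eventually.of_forall fun yz => sub_add_cancel _ _)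
  rw [covariance_eq_sub hkU hkV, hmean U hU hUp, hmean V hV hVp]
  simp only [Pi.mul_apply]
  rw [hjoint, ← integral_prod_mul, ← Measure.volume_eq_prod, ← integral_sub hmain hprod]
  exact integral_mono hdiff hkg' fun yz => (le_abs_self _).trans (hbound yz)

/-- Variance bound for the kernel density estimator under the discrete weak
Castellana–Leadbetter condition (Proposition 2 of the paper, explicit-constant form). -/
theorem stmt3
    {Ω : Type*} [MeasurableSpace Ω] (μ : Measure Ω) [IsProbabilityMeasure μ]
    (n : ℕ) (hn : 1 ≤ n) (Δ T h xstar : ℝ) (hΔ : 0 < Δ) (hT : T = n * Δ) (hh : 0 < h)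
    (X : ℕ → Ω → ℝ) (hX : ∀ i < n, Measurable (X i))
    (π : ℝ → ℝ) (hπm : Measurable π) (hπ0 : ∀ y, 0 ≤ π y)
    (hdens : ∀ i < n,
      Measure.map (X i) μ = volume.withDensity (fun y => ENNReal.ofReal (π y)))
    (hπbdd : eLpNorm π ⊤ volume < ⊤)
    (g : ℕ → ℝ → ℝ → ℝ) (hg : ∀ j, Measurable (Function.uncurry (g j)))
    (hjoint : ∀ j, 1 ≤ j → j ≤ n - 1 → ∀ i, i + j ≤ n - 1 →
      Measure.map (fun ω => (X i ω, X (i + j) ω)) μ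
        = (volume : Measure (ℝ × ℝ)).withDensity
            (fun yz => ENNReal.ofReal (π yz.1 * π yz.2 + g j yz.1 yz.2)))
    (M₁ : ℝ)
    (hM₁ : ∀ y z : ℝ, Δ * ∑ j ∈ Finset.Icc 1 (n - 1), |g j y z| ≤ M₁)
    (K : ℝ → ℝ) (hK1 : MemLp K 1 volume) (hK2 : MemLp K 2 volume)
    (πhat : Ω → ℝ)
    (hπhat : πhat = fun ω =>
      (1 / (n : ℝ)) * ∑ i ∈ Finset.range n, (1 / h) * K ((xstar - X i ω) / h)) :
    variance πhat μ
      ≤ (eLpNorm π ⊤ volume).toReal * ((eLpNorm K 2 volume).toReal) ^ 2 * Δ / (T * h)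
        + 2 * ((eLpNorm K 1 volume).toReal) ^ 2 * M₁ / T := by
  have hn0 : (0 : ℝ) < n := by exact_mod_cast hn
  set k : ℝ → ℝ := fun y => (1 / h) * K ((xstar - y) / h) with hk
  set ν : Measure ℝ := volume.withDensity (fun y => ENNReal.ofReal (π y))
  have hνle : ν ≤ eLpNorm π ⊤ volume • volume := withDensity_le_eLpNorm_top_smul _ _
  have hk1 : Integrable k :=
    (integrable_comp_sub_left_div (memLp_one_iff_integrable.1 hK1) hh xstar).const_mul _
  have hksq : Integrable fun y => k y ^ 2 := by
    simpa only [hk, mul_pow] using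
      (integrable_comp_sub_left_div hK2.integrable_sq hh xstar).const_mul ((1 / h) ^ 2)
  have hk2 : MemLp k 2 ν :=
    ((memLp_two_iff_integrable_sq hk1.1).2 hksq).of_measure_le_smul hπbdd.ne hνle
  have hk_abs : ∫ y, |k y| = (eLpNorm K 1 volume).toReal := by
    rw [toReal_eLpNorm_one hK1]
    simp only [hk, abs_mul, abs_of_pos (one_div_pos.2 hh)]
    rw [integral_const_mul, integral_comp_sub_left_div (fun y => |K y|) hh]
    field_simp
  have hk_sq : ∫ y, k y ^ 2 = (eLpNorm K 2 volume).toReal ^ 2 / h := by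
    rw [toReal_eLpNorm_two_sq hK2]
    simp only [hk, mul_pow]
    rw [integral_const_mul, integral_comp_sub_left_div (fun y => K y ^ 2) hh]
    field_simp
  have hY : ∀ i < n, MemLp (fun ω => k (X i ω)) 2 μ := fun i hi =>
    ((hdens i hi).symm ▸ hk2 : MemLp k 2 (μ.map (X i))).comp_of_map (hX i hi).aemeasurable
  have hvar : ∀ i < n, cov[fun ω => k (X i ω), fun ω => k (X i ω); μ]
      ≤ (eLpNorm π ⊤ volume).toReal * ((eLpNorm K 2 volume).toReal ^ 2 / h) := by
    intro i hi
    rw [covariance_self (hY i hi).aemeasurable]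
    refine (variance_le_expectation_sq (hY i hi).1).trans ?_
    have hmap : ∫ ω, k (X i ω) ^ 2 ∂μ = ∫ y, k y ^ 2 ∂ν := by
      rw [← hdens i hi, integral_map (f := fun y => k y ^ 2) (hX i hi).aemeasurable]
      rw [hdens i hi]
      exact hk2.1.pow 2
    simp only [Pi.pow_apply]
    rw [hmap, ← hk_sq, ← smul_eq_mul, ← integral_smul_measure]
    exact integral_mono_measure hνle (Filter.Eventually.of_forall fun y => sq_nonneg _)
      (hksq.smul_measure hπbdd.ne)
  have hgb : ∀ j ∈ Finset.Icc 1 (n - 1), ∀ y z, |g j y z| ≤ M₁ / Δ := by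
    intro j hj y z
    rw [le_div_iff₀' hΔ]
    refine le_trans ?_ (hM₁ y z)
    gcongr
    exact Finset.single_le_sum (f := fun j => |g j y z|) (fun _ _ => abs_nonneg _) hj
  have hkk : Integrable fun yz : ℝ × ℝ => |k yz.1| * |k yz.2| := hk1.abs.mul_prod hk1.abs
  have hkg : ∀ j ∈ Finset.Icc 1 (n - 1),
      Integrable fun yz : ℝ × ℝ => g j yz.1 yz.2 * (|k yz.1| * |k yz.2|) := fun j hj =>
    hkk.bdd_mul (hg j).aestronglyMeasurable
      (Filter.Eventually.of_forall fun yz => hgb j hj yz.1 yz.2)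
  have hD : ∑ j ∈ Finset.Icc 1 (n - 1), ∫ yz : ℝ × ℝ, |g j yz.1 yz.2| * (|k yz.1| * |k yz.2|)
      ≤ M₁ / Δ * (eLpNorm K 1 volume).toReal ^ 2 := by
    have hint : ∀ j ∈ Finset.Icc 1 (n - 1),
        Integrable fun yz : ℝ × ℝ => |g j yz.1 yz.2| * (|k yz.1| * |k yz.2|) := fun j hj => by
      simpa [abs_mul] using (hkg j hj).abs
    have hsq : ∫ yz : ℝ × ℝ, |k yz.1| * |k yz.2| = (eLpNorm K 1 volume).toReal ^ 2 := by
      rw [Measure.volume_eq_prod, integral_prod_mul (fun y => |k y|) (fun y => |k y|), hk_abs, sq]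
    rw [← integral_finsetSum _ hint, ← hsq, ← integral_const_mul]
    refine integral_mono (integrable_finsetSum _ hint) (hkk.const_mul _) fun yz => ?_
    simp only [← Finset.sum_mul]
    refine mul_le_mul_of_nonneg_right ?_ (by positivity)
    rw [le_div_iff₀' hΔ]
    exact hM₁ yz.1 yz.2
  have hcov : ∀ i j, i < j → j < n → cov[fun ω => k (X i ω), fun ω => k (X j ω); μ]
      ≤ ∫ yz : ℝ × ℝ, |g (j - i) yz.1 yz.2| * (|k yz.1| * |k yz.2|) := by
    intro i j hij hj
    have hjm := hjoint (j - i) (by omega) (by omega) i (by omega)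
    rw [show i + (j - i) = j by omega] at hjm
    exact covariance_comp_le_of_joint_density (hX i (by omega)) (hX j hj) hπm hπ0
      (hdens i (by omega)) (hdens j hj) (hg _) hjm hk1.1 hk2
      (hkg _ (Finset.mem_Icc.2 ⟨by omega, by omega⟩))
  have hrow : ∀ i ∈ Finset.range n,
      ∑ j ∈ Finset.range n, cov[fun ω => k (X i ω), fun ω => k (X j ω); μ]
      ≤ (eLpNorm π ⊤ volume).toReal * ((eLpNorm K 2 volume).toReal ^ 2 / h)
        + 2 * (M₁ / Δ * (eLpNorm K 1 volume).toReal ^ 2) := by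
    intro i hi
    have hi' := Finset.mem_range.1 hi
    refine sum_range_le_of_dist_bound hi' _ _ _ _
      (fun j => integral_nonneg fun yz => by positivity) hD (hvar i hi') (fun j hj => ?_)
      fun j hij hj => hcov i j hij hj
    rw [covariance_comm]
    exact hcov j i hj hi'
  rw [hπhat, variance_const_mul,
    variance_fun_sum' (X := fun i ω => k (X i ω)) fun i hi => hY i (Finset.mem_range.1 hi)]
  refine (mul_le_mul_of_nonneg_left (Finset.sum_le_sum hrow) (sq_nonneg _)).trans (le_of_eq ?_)
  rw [Finset.sum_const, Finset.card_range, nsmul_eq_mul, hT]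
  field_simp
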